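/- Let τ be an infinite cardinal and κ an ordinal with cf(κ) > τ. Let D^τ = {0,1}^τ with the product topology, z_α ∈ D^τ the point whose only nonzero coordinate is the α-th, Z = {z_α : α < τ}, X₁ = Z × {κ}, and X = (D^τ × [0,κ]) \ ((D^τ \ Z) × {κ}) with the subspace topology of D^τ × [0,κ]. Then X₁ is relatively star-Lindelöf in X: for every open cover 𝒰 of X there exists a countable set A ⊆ X such that X₁ ⊆ St(A,𝒰). -/

import Mathlib

open Set Cardinal
open scoped Classical

universe u

/-- The point of the Cantor cube `ι → Bool` whose only nonzero coordinate is the `α`-th. -/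
noncomputable def zpt {ι : Type u} (α : ι) : ι → Bool := fun i => if i = α then true else false

/-- `Z = {z_α : α < τ}`. -/
def Zset (ι : Type u) : Set (ι → Bool) := Set.range (zpt (ι := ι))

/-- `X = (D^τ × [0,κ]) \ ((D^τ \ Z) × {κ})`, as a subset of `D^τ × [0,κ]`. -/
def Xset (ι : Type u) (κ : Ordinal.{u}) : Set ((ι → Bool) × ↥(Set.Iic κ)) :=
  {p | (p.2 : Ordinal) = κ → p.1 ∈ Zset ι}

/-- `X₁ = Z × {κ}`, as a subset of `X`. -/
def X1set (ι : Type u) (κ : Ordinal.{u}) : Set ↥(Xset ι κ) :=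
  {x | (x : (ι → Bool) × ↥(Set.Iic κ)).1 ∈ Zset ι ∧
    ((x : (ι → Bool) × ↥(Set.Iic κ)).2 : Ordinal) = κ}

/-- If every vertex has at most `n` out-neighbours, then any finite set of vertices admits a proper
colouring with `2 * n + 1` colours. -/
theorem exists_finset_coloring {ι : Type*} (F : ι → Finset ι) (n : ℕ) (V : Finset ι)
    (hF : ∀ a ∈ V, (F a).card ≤ n) :
    ∃ c : ι → Fin (2 * n + 1), ∀ a ∈ V, ∀ b ∈ V, b ∈ F a → b ≠ a → c a ≠ c b := by
  induction V using Finset.strongInduction with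
  | H V ih =>
    rcases V.eq_empty_or_nonempty with rfl | hne
    · exact ⟨fun _ => 0, by simp⟩
    obtain ⟨v, hv, hin⟩ : ∃ v ∈ V, (V.filter fun a => v ∈ F a).card ≤ n := by
      by_contra! h
      have hlt : ∑ _v ∈ V, n < ∑ v ∈ V, (V.filter fun a => v ∈ F a).card :=
        Finset.sum_lt_sum_of_nonempty hne h
      have hcount := Finset.sum_card_bipartiteAbove_eq_sum_card_bipartiteBelow
        (s := V) (t := V) fun a b => b ∈ F a
      have hle : ∑ a ∈ V, (V.filter fun b => b ∈ F a).card ≤ ∑ _a ∈ V, n := by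
        refine Finset.sum_le_sum fun a ha => (Finset.card_le_card ?_).trans (hF a ha)
        intro b hb
        exact (Finset.mem_filter.1 hb).2
      simp only [Finset.bipartiteAbove, Finset.bipartiteBelow] at hcount
      omega
    obtain ⟨c, hc⟩ := ih (V.erase v) (Finset.erase_ssubset hv)
      fun a ha => hF a (Finset.mem_of_mem_erase ha)
    obtain ⟨k, hk⟩ : ∃ k, k ∉ ((V.filter fun a => v ∈ F a) ∪ F v).image c := by
      by_contra! h
      have hcard := Finset.card_le_card fun k (_ : k ∈ Finset.univ) => h k
      have h₁ := hcard.trans (Finset.card_image_le.trans (Finset.card_union_le _ _))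
      have h₂ := hF v hv
      rw [Finset.card_univ, Fintype.card_fin] at h₁
      omega
    simp only [Finset.mem_image, Finset.mem_union, Finset.mem_filter, not_exists, not_and] at hk
    refine ⟨Function.update c v k, fun a ha b hb hab hne => ?_⟩
    by_cases hav : a = v
    · subst hav
      rw [Function.update_self, Function.update_of_ne hne]
      exact fun h => hk b (Or.inr hab) h.symm
    by_cases hbv : b = v
    · subst hbv
      rw [Function.update_self, Function.update_of_ne hav]
      exact hk a (Or.inl ⟨ha, hab⟩)
    rw [Function.update_of_ne hav, Function.update_of_ne hbv]
    exact hc a (Finset.mem_erase.2 ⟨hav, ha⟩) b (Finset.mem_erase.2 ⟨hbv, hb⟩) hab hne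

/-- A digraph all of whose out-neighbourhoods are finite has countable chromatic number. -/
theorem exists_nat_coloring {ι : Type*} (F : ι → Finset ι) :
    ∃ c : ι → ℕ × ℕ, ∀ a, ∀ b ∈ F a, b ≠ a → c a ≠ c b := by
  have hfin (n : ℕ) : ∃ c : ι → Fin (2 * n + 1), ∀ a b, (F a).card = n → (F b).card = n →
      b ∈ F a → b ≠ a → c a ≠ c b := by
    choose g hg using fun V : Finset ι =>
      exists_finset_coloring F n (V.filter fun a => (F a).card = n)
        fun a ha => (Finset.mem_filter.1 ha).2.le
    obtain ⟨c, hc⟩ := Finset.rado_selection g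
    refine ⟨c, fun a b ha hb hab hne => ?_⟩
    obtain ⟨t, ht, hct⟩ := hc {a, b}
    rw [hct a (by simp), hct b (by simp)]
    exact hg t a (Finset.mem_filter.2 ⟨ht (by simp), ha⟩) b
      (Finset.mem_filter.2 ⟨ht (by simp), hb⟩) hab hne
  choose c hc using hfin
  refine ⟨fun a => ((F a).card, c (F a).card a), fun a b hab hne h => ?_⟩
  obtain ⟨hcard, hcol⟩ := Prod.ext_iff.1 h
  dsimp only at hcard hcol
  rw [← hcard] at hcol
  exact hc _ a b rfl hcard.symm hab hne (Fin.ext hcol)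

/-- An open neighbourhood of `(z_α, κ)` in `X` contains a basic one. -/
theorem exists_basic_subset_of_isOpen {ι : Type u} {κ : Ordinal.{u}} (hκ : 0 < κ) (α : ι)
    (U : Set ↥(Xset ι κ)) (hU : IsOpen U) (x : ↥(Xset ι κ)) (hxU : x ∈ U)
    (hx₁ : x.1.1 = zpt α) (hx₂ : (x.1.2 : Ordinal) = κ) :
    ∃ (F : Finset ι) (β : Ordinal.{u}), β < κ ∧ ∀ y : ↥(Xset ι κ),
      (∀ i ∈ F, y.1.1 i = zpt α i) → β < (y.1.2 : Ordinal) → y ∈ U := by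
  obtain ⟨V, hV, rfl⟩ := isOpen_induced_iff.1 hU
  obtain ⟨P, Q, hP, hQ, hxP, hxQ, hPQ⟩ := isOpen_prod_iff.1 hV x.1.1 x.1.2 hxU
  obtain ⟨W, hW, rfl⟩ := isOpen_induced_iff.1 hQ
  obtain ⟨F, u, hu, hFu⟩ := isOpen_pi_iff.1 hP _ hxP
  have hκW : κ ∈ W := hx₂ ▸ hxQ
  obtain ⟨β, hβ, hβW⟩ := exists_Ioc_subset_of_mem_nhds (hW.mem_nhds hκW) ⟨0, hκ⟩
  refine ⟨F, β, hβ, fun y hyF hyβ => hPQ ⟨hFu fun i hi => ?_, hβW ⟨hyβ, y.1.2.2⟩⟩⟩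
  rw [hyF i hi, ← hx₁]
  exact (hu i hi).2

/-- With `τ` infinite, `cf(κ) > τ`, and `X` the space above, the set `X₁ = Z × {κ}` is
relatively star-Lindelöf in `X`: for every open cover `𝒰` of `X` there is a countable
`A ⊆ X` with `X₁ ⊆ St(A,𝒰)`. -/
theorem X1_relatively_star_lindelof
    (τ : Cardinal.{u}) (hτ : ℵ₀ ≤ τ) (κ : Ordinal.{u}) (hκ : τ < κ.cof)
    (ι : Type u) (hι : #ι = τ) :
    ∀ 𝒰 : Set (Set ↥(Xset ι κ)), (∀ U ∈ 𝒰, IsOpen U) → ⋃₀ 𝒰 = Set.univ →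
      ∃ A : Set ↥(Xset ι κ), A.Countable ∧
        X1set ι κ ⊆ ⋃₀ {U ∈ 𝒰 | (U ∩ A).Nonempty} := by
  intro 𝒰 hopen hcover
  have hκ₀ : 0 < κ := by
    rw [pos_iff_ne_zero]
    rintro rfl
    simp at hκ
  let p (α : ι) : ↥(Xset ι κ) := ⟨(zpt α, ⟨κ, self_mem_Iic⟩), fun _ => ⟨α, rfl⟩⟩
  have hmem (α : ι) : ∃ U ∈ 𝒰, p α ∈ U := mem_sUnion.1 (hcover ▸ mem_univ (p α))
  choose U hU hpU using hmem
  choose F β hβ hFβ using fun α =>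
    exists_basic_subset_of_isOpen hκ₀ α (U α) (hopen _ (hU α)) (p α) (hpU α) rfl rfl
  obtain ⟨c, hc⟩ := exists_nat_coloring F
  have hγ : ⨆ α, (β α + 1) < κ := Ordinal.iSup_add_one_lt_of_lt_cof (hι ▸ hκ) hβ
  let q (k : ℕ × ℕ) : ↥(Xset ι κ) :=
    ⟨(fun i => decide (c i = k), ⟨⨆ α, (β α + 1), hγ.le⟩), fun h => absurd h hγ.ne⟩
  refine ⟨range q, countable_range q, fun x hx => ?_⟩
  obtain ⟨⟨α, hα⟩, hxκ⟩ := hx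
  have hxp : x = p α := Subtype.ext (Prod.ext hα.symm (Subtype.ext hxκ))
  refine ⟨U α, ⟨hU α, q (c α), hFβ α _ (fun i hi => ?_) (Ordinal.lt_iSup_add_one β α),
    mem_range_self _⟩, hxp ▸ hpU α⟩
  by_cases h : i = α
  · simp [q, zpt, h]
  · simpa [q, zpt, h] using (hc α i hi h).symm
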